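/- For every λ > 0, let E_n^λ denote the OEDG solution operator for the scaled equation u_t + λβ u_x = 0 on the same mesh with the same Runge–Kutta method, time step τ_λ = τ/λ, upwind DG operator λL, and wave speeds β_j = λβ in the OE operator; let E_n be the OEDG solution operator for u_t + βu_x = 0 with time step τ. Then E_n^λ = E_n for all n ≥ 0 and all λ > 0. (Evolution invariance; Theorem 2.3.) -/

import Mathlib

open Polynomial Finset MeasureTheory

namespace OEDG

variable {N : ℕ}

/-- `pt` lists the nodes `x_{1/2} < x_{3/2} < … < x_{N+1/2}` of a partition of `Ω = [0,1]`. -/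
def IsMesh (pt : Fin (N+1) → ℝ) : Prop :=
  pt 0 = 0 ∧ pt (Fin.last N) = 1 ∧ StrictMono pt

/-- Left endpoint of cell `j`. -/
def ptL (pt : Fin (N+1) → ℝ) (j : Fin N) : ℝ := pt j.castSucc

/-- Right endpoint of cell `j`. -/
def ptR (pt : Fin (N+1) → ℝ) (j : Fin N) : ℝ := pt j.succ

/-- Length `h_j` of cell `j`. -/
def cellh (pt : Fin (N+1) → ℝ) (j : Fin N) : ℝ := ptR pt j - ptL pt j

/-- Maximal mesh size `h`. -/
noncomputable def meshSize (pt : Fin (N+1) → ℝ) : ℝ := ⨆ j : Fin N, cellh pt j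

/-- Quasi-uniformity of the partition: `h ≤ γ h_j` for all `j`. -/
def QuasiUniform (pt : Fin (N+1) → ℝ) (γ : ℝ) : Prop :=
  ∀ j : Fin N, meshSize pt ≤ γ * cellh pt j

/-- Membership in `V^k`: every cell polynomial has degree at most `k`. -/
def MemVk (k : ℕ) (u : Fin N → Polynomial ℝ) : Prop :=
  ∀ j, (u j).natDegree ≤ k

/-- Cellwise `L²` inner product. -/
noncomputable def cip (pt : Fin (N+1) → ℝ) (j : Fin N) (p q : Polynomial ℝ) : ℝ :=
  ∫ x in (ptL pt j)..(ptR pt j), p.eval x * q.eval x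

/-- Global `L²(Ω)` inner product of piecewise polynomials. -/
noncomputable def ip (pt : Fin (N+1) → ℝ) (u v : Fin N → Polynomial ℝ) : ℝ :=
  ∑ j : Fin N, cip pt j (u j) (v j)

/-- Cellwise `L²` norm. -/
noncomputable def cl2 (pt : Fin (N+1) → ℝ) (j : Fin N) (p : Polynomial ℝ) : ℝ :=
  Real.sqrt (cip pt j p p)

/-- Global `L²(Ω)` norm of a piecewise polynomial. -/
noncomputable def l2 (pt : Fin (N+1) → ℝ) (u : Fin N → Polynomial ℝ) : ℝ :=
  Real.sqrt (ip pt u u)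

/-- Average `avg(u) = (1/|Ω|) ∫_Ω u dx` (here `|Ω| = 1`). -/
noncomputable def avg (pt : Fin (N+1) → ℝ) (u : Fin N → Polynomial ℝ) : ℝ :=
  ∑ j : Fin N, ∫ x in (ptL pt j)..(ptR pt j), (u j).eval x

/-- `‖u - c‖_{L∞(Ω)}` for a piecewise polynomial `u` and a constant `c`. -/
noncomputable def linfSub (pt : Fin (N+1) → ℝ) (u : Fin N → Polynomial ℝ) (c : ℝ) : ℝ :=
  ⨆ j : Fin N, sSup ((fun x => |(u j).eval x - c|) '' Set.Icc (ptL pt j) (ptR pt j))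

/-- `m`-th derivative of a polynomial. -/
noncomputable def pderiv (m : ℕ) (p : Polynomial ℝ) : Polynomial ℝ :=
  (fun q : Polynomial ℝ => Polynomial.derivative q)^[m] p

/-- Jump `[∂_x^m u]_{j+1/2}` of the `m`-th derivative at the interface to the right of
cell `j`, with periodic identification of `x_{N+1/2}` with `x_{1/2}`. -/
noncomputable def jumpD [NeZero N] (pt : Fin (N+1) → ℝ) (u : Fin N → Polynomial ℝ)
    (m : ℕ) (j : Fin N) : ℝ :=
  (pderiv m (u (j+1))).eval (pt (Fin.castSucc (j+1))) - (pderiv m (u j)).eval (pt j.succ)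

/-- The scale-invariant damping coefficient `σ_j^m(u)` of the OEDG method. -/
noncomputable def sigma [NeZero N] (k : ℕ) (pt : Fin (N+1) → ℝ)
    (u : Fin N → Polynomial ℝ) (m : ℕ) (j : Fin N) : ℝ :=
  if ∀ i, u i = Polynomial.C (avg pt u) then 0
  else (2*(m:ℝ)+1) * (cellh pt j)^m / ((2*(k:ℝ)-1) * (Nat.factorial m)) *
    ((|jumpD pt u m (j-1)| + |jumpD pt u m j|) / (2 * linfSub pt u (avg pt u)))

/-- Damping rate `δ_j^m = β_j σ_j^m(u) / h_j`. -/
noncomputable def dampRate [NeZero N] (k : ℕ) (pt : Fin (N+1) → ℝ) (β : Fin N → ℝ)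
    (u : Fin N → Polynomial ℝ) (m : ℕ) (j : Fin N) : ℝ :=
  β j * sigma k pt u m j / cellh pt j

/-- `Pc j d` is the cellwise `L²(I_j)`-orthogonal projection onto `ℙ^d(I_j)`.
(The family `Pc` realizes the global projections `P^d` onto `V^d`.) -/
def IsCellProj (pt : Fin (N+1) → ℝ)
    (Pc : Fin N → ℕ → Polynomial ℝ → Polynomial ℝ) : Prop :=
  ∀ (j : Fin N) (dd : ℕ) (p : Polynomial ℝ), (Pc j dd p).natDegree ≤ dd ∧
    ∀ q : Polynomial ℝ, q.natDegree ≤ dd → cip pt j (p - Pc j dd p) q = 0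

/-- `w` solves the damping initial value problem with initial data `u`:
`d/dt̂ ∫_{I_j} u_σ v dx + ∑_{m=0}^k (β_j σ_j^m(u)/h_j) ∫_{I_j} (u_σ - P^{m-1} u_σ) v dx = 0`
for every `v ∈ ℙ^k(I_j)` and every `j`, with `u_σ(·,0) = u`.  (Note `m - 1` is
truncated ℕ-subtraction, which realizes the convention `P^{-1} = P^0`.) -/
def IsDampingSol [NeZero N] (k : ℕ) (pt : Fin (N+1) → ℝ) (β : Fin N → ℝ)
    (Pc : Fin N → ℕ → Polynomial ℝ → Polynomial ℝ)
    (u : Fin N → Polynomial ℝ) (w : ℝ → Fin N → Polynomial ℝ) : Prop :=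
  w 0 = u ∧ (∀ t j, (w t j).natDegree ≤ k) ∧
  ∀ (t : ℝ) (j : Fin N) (v : Polynomial ℝ), v.natDegree ≤ k →
    HasDerivAt (fun s => cip pt j (w s j) v)
      (-(∑ m ∈ Finset.range (k+1),
        dampRate k pt β u m j * cip pt j (w t j - Pc j (m-1) (w t j)) v)) t

/-- `Fτ` is the OE (oscillation-eliminating) operator: for every `u ∈ V^k` the damping
initial value problem has a solution `w` and `Fτ u = w τ`. -/
def IsOEOp [NeZero N] (k : ℕ) (pt : Fin (N+1) → ℝ) (β : Fin N → ℝ)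
    (Pc : Fin N → ℕ → Polynomial ℝ → Polynomial ℝ) (τ : ℝ)
    (Fτ : (Fin N → Polynomial ℝ) → (Fin N → Polynomial ℝ)) : Prop :=
  ∀ u, MemVk k u → ∃ w, IsDampingSol k pt β Pc u w ∧ Fτ u = w τ

/-- Right-hand side of the weak form of the upwind DG operator for `u_t + β u_x = 0`:
`β ∫_{I_j} w v_x dx - β w(x_{j+1/2}^-) v(x_{j+1/2}^-) + β w(x_{j-1/2}^-) v(x_{j-1/2}^+)`. -/
noncomputable def dgRHS [NeZero N] (pt : Fin (N+1) → ℝ) (β : ℝ)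
    (w : Fin N → Polynomial ℝ) (j : Fin N) (v : Polynomial ℝ) : ℝ :=
  β * (∫ x in (ptL pt j)..(ptR pt j), (w j).eval x * (Polynomial.derivative v).eval x)
  - β * (w j).eval (ptR pt j) * v.eval (ptR pt j)
  + β * (w (j-1)).eval (pt (j-1).succ) * v.eval (ptL pt j)

/-- `L` is the upwind DG spatial operator on `V^k`. -/
def IsDGOp [NeZero N] (k : ℕ) (pt : Fin (N+1) → ℝ) (β : ℝ)
    (L : (Fin N → Polynomial ℝ) → (Fin N → Polynomial ℝ)) : Prop :=
  ∀ w, MemVk k w → MemVk k (L w) ∧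
    ∀ (j : Fin N) (v : Polynomial ℝ), v.natDegree ≤ k →
      cip pt j (L w j) v = dgRHS pt β w j v

/-- The upwind DG bilinear form
`H(w,v) = β ∑_j ∫_{I_j} w v_x dx + β ∑_j w(x_{j+1/2}^-) [v]_{j+1/2}`. -/
noncomputable def Hform [NeZero N] (pt : Fin (N+1) → ℝ) (β : ℝ)
    (w v : Fin N → Polynomial ℝ) : ℝ :=
  β * ∑ j : Fin N, (∫ x in (ptL pt j)..(ptR pt j),
      (w j).eval x * (Polynomial.derivative (v j)).eval x)
  + β * ∑ j : Fin N, (w j).eval (ptR pt j) * jumpD pt v 0 j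

/-- The upwind DG bilinear form with piecewise-smooth first argument. -/
noncomputable def HformF [NeZero N] (pt : Fin (N+1) → ℝ) (β : ℝ)
    (w : Fin N → ℝ → ℝ) (v : Fin N → Polynomial ℝ) : ℝ :=
  β * ∑ j : Fin N, (∫ x in (ptL pt j)..(ptR pt j),
      w j x * (Polynomial.derivative (v j)).eval x)
  + β * ∑ j : Fin N, w j (ptR pt j) * jumpD pt v 0 j

/-- `L²(Ω)` pairing of a piecewise-smooth function with a piecewise polynomial. -/
noncomputable def ipF (pt : Fin (N+1) → ℝ) (w : Fin N → ℝ → ℝ)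
    (v : Fin N → Polynomial ℝ) : ℝ :=
  ∑ j : Fin N, ∫ x in (ptL pt j)..(ptR pt j), w j x * (v j).eval x

/-- One Runge–Kutta stage: `∑_{0≤m≤ℓ} (c_{ℓm} u_σ^{n,m} + τ d_{ℓm} L(u_σ^{n,m}))`. -/
noncomputable def rkStage [NeZero N] (c d : ℕ → ℕ → ℝ) (τ : ℝ)
    (L : (Fin N → Polynomial ℝ) → (Fin N → Polynomial ℝ))
    (uσ : ℕ → Fin N → Polynomial ℝ) (ℓ : ℕ) : Fin N → Polynomial ℝ :=
  fun j => ∑ m ∈ Finset.range (ℓ+1),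
    (Polynomial.C (c ℓ m) * uσ m j + Polynomial.C (τ * d ℓ m) * L (uσ m) j)

/-- One full OEDG time step from `u_σ^n = un`: the stages `u_h^{n,ℓ+1}` and
`u_σ^{n,ℓ+1} = F_τ u_h^{n,ℓ+1}`, `0 ≤ ℓ ≤ s-1`. -/
def IsOEDGStep [NeZero N] (s : ℕ) (c d : ℕ → ℕ → ℝ) (τ : ℝ)
    (L Fτ : (Fin N → Polynomial ℝ) → (Fin N → Polynomial ℝ))
    (un : Fin N → Polynomial ℝ) (uh uσ : ℕ → Fin N → Polynomial ℝ) : Prop :=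
  uσ 0 = un ∧ ∀ ℓ < s, uh (ℓ+1) = rkStage c d τ L uσ ℓ ∧ uσ (ℓ+1) = Fτ (uh (ℓ+1))

/-- The full OEDG evolution: `uσ n ℓ = u_σ^{n,ℓ}` and `uh n ℓ = u_h^{n,ℓ}`, starting from
`u_σ^0 = u0`, with `u_σ^{n+1} = u_σ^{n,s}`. -/
def IsOEDGEvol [NeZero N] (s : ℕ) (c d : ℕ → ℕ → ℝ) (τ : ℝ)
    (L Fτ : (Fin N → Polynomial ℝ) → (Fin N → Polynomial ℝ))
    (u0 : Fin N → Polynomial ℝ) (uh uσ : ℕ → ℕ → Fin N → Polynomial ℝ) : Prop :=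
  uσ 0 0 = u0 ∧ ∀ n, uσ (n+1) 0 = uσ n s ∧
    ∀ ℓ < s, uh n (ℓ+1) = rkStage c d τ L (uσ n) ℓ ∧ uσ n (ℓ+1) = Fτ (uh n (ℓ+1))

/-- `p` is the Gauss–Radau projection of `w` on `[a,b]` into `ℙ^k`:
`∫_a^b (w - p) q dx = 0` for all `q ∈ ℙ^{k-1}` and `p(b) = w(b)`. -/
def IsGRProj (k : ℕ) (a b : ℝ) (w : ℝ → ℝ) (p : Polynomial ℝ) : Prop :=
  p.natDegree ≤ k ∧
  (∀ q : Polynomial ℝ, q.natDegree < k →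
    (∫ x in a..b, (w x - p.eval x) * q.eval x) = 0) ∧
  p.eval b = w b

/-- `u = u(x,t)` is a smooth `1`-periodic exact solution of `u_t + β u_x = 0`. -/
def IsSmoothSolution (β : ℝ) (u : ℝ → ℝ → ℝ) : Prop :=
  ContDiff ℝ (⊤ : ℕ∞) (fun p : ℝ × ℝ => u p.1 p.2) ∧
  (∀ x t, u (x+1) t = u x t) ∧
  (∀ x t, deriv (fun s => u x s) t + β * deriv (fun y => u y t) x = 0)

/-- Auxiliary table for the reference functions `U^{n,ℓ}`. -/
noncomputable def UrefUpTo (u : ℝ → ℝ → ℝ) (c d : ℕ → ℕ → ℝ) (β τ : ℝ) (n : ℕ) :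
    ℕ → ℕ → ℝ → ℝ
  | 0 => fun _ => fun x => u x ((n:ℝ) * τ)
  | (ℓ+1) => fun i =>
      if i ≤ ℓ then UrefUpTo u c d β τ n ℓ i
      else fun x => ∑ m ∈ Finset.range (ℓ+1),
        (c ℓ m * UrefUpTo u c d β τ n ℓ m x
          - τ * d ℓ m * β * deriv (UrefUpTo u c d β τ n ℓ m) x)

/-- Reference function `U^{n,ℓ}` (for `0 ≤ ℓ ≤ s-1`): `U^{n,0} = u(·, t^n)` and
`U^{n,ℓ+1} = ∑_{0≤m≤ℓ} (c_{ℓm} U^{n,m} - τ d_{ℓm} β ∂_x U^{n,m})`. -/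
noncomputable def Uref (u : ℝ → ℝ → ℝ) (c d : ℕ → ℕ → ℝ) (β τ : ℝ) (n ℓ : ℕ) : ℝ → ℝ :=
  UrefUpTo u c d β τ n ℓ ℓ

/-- Reference function `U^{n,ℓ}` including the final stage `U^{n,s} := u(·, t^{n+1})`. -/
noncomputable def UrefS (u : ℝ → ℝ → ℝ) (c d : ℕ → ℕ → ℝ) (β τ : ℝ) (s n ℓ : ℕ) : ℝ → ℝ :=
  if ℓ = s then fun x => u x (((n:ℝ)+1) * τ) else Uref u c d β τ n ℓ

/-- The Runge–Kutta residual `ρ^{n,s-1}`, defined so that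
`U^{n,s} = ∑_{0≤m≤s-1} (c_{s-1,m} U^{n,m} - τ d_{s-1,m} β ∂_x U^{n,m}) + τ ρ^{n,s-1}`. -/
noncomputable def rkRes (u : ℝ → ℝ → ℝ) (c d : ℕ → ℕ → ℝ) (β τ : ℝ) (s n : ℕ) : ℝ → ℝ :=
  fun x => (u x (((n:ℝ)+1) * τ) - ∑ m ∈ Finset.range s,
    (c (s-1) m * Uref u c d β τ n m x
      - τ * d (s-1) m * β * deriv (Uref u c d β τ n m) x)) / τ

/-- `L²(0,1)` norm of a function. -/
noncomputable def fl2 (f : ℝ → ℝ) : ℝ := Real.sqrt (∫ x in (0:ℝ)..1, (f x)^2)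

/-- `L²(Ω)` distance between a piecewise polynomial and a function. -/
noncomputable def errL2 (pt : Fin (N+1) → ℝ) (w : Fin N → Polynomial ℝ) (f : ℝ → ℝ) : ℝ :=
  Real.sqrt (∑ j : Fin N, ∫ x in (ptL pt j)..(ptR pt j), ((w j).eval x - f x)^2)


section Auxiliary

variable (pt : Fin (N+1) → ℝ) (j : Fin N)

lemma intervalIntegrable_eval_mul_eval (a b : ℝ) (p q : Polynomial ℝ) :
    IntervalIntegrable (fun x => p.eval x * q.eval x) volume a b :=
  (p.continuous.mul q.continuous).intervalIntegrable _ _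

lemma cip_comm (p q : Polynomial ℝ) : cip pt j p q = cip pt j q p := by
  simp only [cip, mul_comm]

lemma cip_sub_left (p q v : Polynomial ℝ) :
    cip pt j (p - q) v = cip pt j p v - cip pt j q v := by
  simp only [cip, eval_sub, sub_mul]
  exact intervalIntegral.integral_sub (intervalIntegrable_eval_mul_eval _ _ _ _)
    (intervalIntegrable_eval_mul_eval _ _ _ _)

lemma cip_C_mul_left (a : ℝ) (p v : Polynomial ℝ) :
    cip pt j (C a * p) v = a * cip pt j p v := by
  simp only [cip, eval_mul, eval_C, mul_assoc]
  exact intervalIntegral.integral_const_mul _ _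

variable {pt}

lemma IsMesh.ptL_lt_ptR (hpt : IsMesh pt) : ptL pt j < ptR pt j :=
  hpt.2.2 Fin.castSucc_lt_succ

variable {j}

/-- The cellwise inner product is definite. -/
lemma IsMesh.eq_zero_of_cip_self_eq_zero (hpt : IsMesh pt) {p : Polynomial ℝ}
    (h : cip pt j p p = 0) : p = 0 := by
  have hlt := hpt.ptL_lt_ptR j
  by_contra hp
  refine hp (Polynomial.eq_zero_of_infinite_isRoot p
    ((Set.Icc_infinite hlt).mono fun x hx => ?_))
  by_contra hx0
  have hpos : 0 < ∫ x in (ptL pt j)..(ptR pt j), p.eval x * p.eval x :=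
    intervalIntegral.integral_pos hlt (p.continuous.mul p.continuous).continuousOn
      (fun y _ => mul_self_nonneg _) ⟨x, hx, mul_self_pos.2 hx0⟩
  exact hpos.ne' h

/-- Polynomials of degree at most `k` are separated by their moments against `ℙ^k`. -/
lemma IsMesh.eq_of_forall_cip_eq (hpt : IsMesh pt) {k : ℕ} {p q : Polynomial ℝ}
    (hp : p.natDegree ≤ k) (hq : q.natDegree ≤ k)
    (h : ∀ v : Polynomial ℝ, v.natDegree ≤ k → cip pt j p v = cip pt j q v) : p = q := by
  refine sub_eq_zero.1 (hpt.eq_zero_of_cip_self_eq_zero (j := j) ?_)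
  rw [cip_sub_left, h _ ((natDegree_sub_le_of_le hp hq).trans_eq (max_self k)), sub_self]

variable {Pc : Fin N → ℕ → Polynomial ℝ → Polynomial ℝ}

/-- The cellwise projections are symmetric. -/
lemma IsCellProj.cip_proj_left (hPc : IsCellProj pt Pc) (i : ℕ) (p v : Polynomial ℝ) :
    cip pt j (Pc j i p) v = cip pt j p (Pc j i v) := by
  have h₁ := (hPc j i p).2 _ (hPc j i v).1
  have h₂ := (hPc j i v).2 _ (hPc j i p).1
  rw [cip_sub_left] at h₁ h₂
  linarith [cip_comm pt j v (Pc j i p), cip_comm pt j (Pc j i v) (Pc j i p)]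

lemma IsCellProj.proj_eq_self (hpt : IsMesh pt) (hPc : IsCellProj pt Pc) {i : ℕ}
    {v : Polynomial ℝ} (hv : v.natDegree ≤ i) : Pc j i v = v :=
  (sub_eq_zero.1 (hpt.eq_zero_of_cip_self_eq_zero (j := j)
    ((hPc j i v).2 _ ((natDegree_sub_le_of_le hv (hPc j i v).1).trans_eq (max_self i))))).symm

/-- The scalar linear initial value problem `y' = a y`, `y 0 = 0` has only the zero solution. -/
lemma eq_zero_of_hasDerivAt_mul {a : ℝ} {y : ℝ → ℝ}
    (hy : ∀ t, HasDerivAt y (a * y t) t) (h0 : y 0 = 0) (t : ℝ) : y t = 0 := by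
  have hd (t : ℝ) : HasDerivAt (fun t => y t * Real.exp (-a * t)) 0 t := by
    have he : HasDerivAt (fun t : ℝ => Real.exp (-a * t)) (Real.exp (-a * t) * (-a)) t := by
      simpa using ((hasDerivAt_id t).const_mul (-a)).exp
    exact ((hy t).mul he).congr_deriv (by ring)
  have hconst := is_const_of_deriv_eq_zero (fun t => (hd t).differentiableAt)
    (fun t => (hd t).deriv) t 0
  simpa [h0] using hconst

variable [NeZero N] {k : ℕ}

/-- The damping initial value problem has at most one solution. -/
lemma IsDampingSol.eq (hpt : IsMesh pt) (hPc : IsCellProj pt Pc) {β : Fin N → ℝ}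
    {u : Fin N → Polynomial ℝ} {w₁ w₂ : ℝ → Fin N → Polynomial ℝ}
    (h₁ : IsDampingSol k pt β Pc u w₁) (h₂ : IsDampingSol k pt β Pc u w₂) : w₁ = w₂ := by
  funext t j
  refine hpt.eq_of_forall_cip_eq (j := j) (h₁.2.1 t j) (h₂.2.1 t j) ?_
  suffices H : ∀ i : ℕ, ∀ v : Polynomial ℝ, v.natDegree ≤ i → v.natDegree ≤ k →
      ∀ t, cip pt j (w₁ t j) v - cip pt j (w₂ t j) v = 0 from
    fun v hv => sub_eq_zero.1 (H k v hv hv t)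
  intro i
  induction i using Nat.strong_induction_on with
  | _ i ih =>
    intro v hvi hvk
    refine eq_zero_of_hasDerivAt_mul
      (a := -∑ m ∈ Finset.range (k+1), if m - 1 < i then dampRate k pt β u m j else 0)
      (fun t => ?_) (by rw [h₁.1, h₂.1, sub_self])
    refine ((h₁.2.2 t j v hvk).sub (h₂.2.2 t j v hvk)).congr_deriv (Eq.symm ?_)
    rw [neg_mul, Finset.sum_mul, neg_sub_neg, ← Finset.sum_sub_distrib,
      ← Finset.sum_neg_distrib]
    refine Finset.sum_congr rfl fun m _ => ?_
    rw [cip_sub_left, cip_sub_left, hPc.cip_proj_left, hPc.cip_proj_left]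
    split_ifs with hm
    · have hdeg := (hPc j (m-1) v).1
      have hproj := ih (m-1) hm (Pc j (m-1) v) hdeg (by grind) t
      linear_combination (-dampRate k pt β u m j) * hproj
    · rw [hPc.proj_eq_self hpt (by omega)]
      ring

/-- Rescaling time in the damping problem amounts to rescaling the wave speeds. -/
lemma IsDampingSol.rescale {β lam : ℝ} (hlam : lam ≠ 0) {u : Fin N → Polynomial ℝ}
    {w : ℝ → Fin N → Polynomial ℝ} (h : IsDampingSol k pt (fun _ => lam * β) Pc u w) :
    IsDampingSol k pt (fun _ => β) Pc u (fun t => w (t / lam)) := by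
  refine ⟨by simpa using h.1, fun t => h.2.1 _, fun t j v hv => ?_⟩
  refine ((h.2.2 (t / lam) j v hv).comp t ((hasDerivAt_id t).div_const lam)).congr_deriv ?_
  rw [neg_mul, Finset.sum_mul]
  congr 1
  refine Finset.sum_congr rfl fun m _ => ?_
  simp only [dampRate]
  field_simp

lemma IsOEOp.eq_rescale (hpt : IsMesh pt) (hPc : IsCellProj pt Pc) {β lam τ : ℝ}
    (hlam : lam ≠ 0) {F F' : (Fin N → Polynomial ℝ) → (Fin N → Polynomial ℝ)}
    (hF : IsOEOp k pt (fun _ => β) Pc τ F)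
    (hF' : IsOEOp k pt (fun _ => lam * β) Pc (τ / lam) F')
    {u : Fin N → Polynomial ℝ} (hu : MemVk k u) : F' u = F u := by
  obtain ⟨w, hw, hFw⟩ := hF u hu
  obtain ⟨w', hw', hFw'⟩ := hF' u hu
  rw [hFw, hFw', hw.eq hpt hPc (hw'.rescale hlam)]

lemma IsOEOp.memVk {β : Fin N → ℝ} {τ : ℝ}
    {F : (Fin N → Polynomial ℝ) → (Fin N → Polynomial ℝ)} (hF : IsOEOp k pt β Pc τ F)
    {u : Fin N → Polynomial ℝ} (hu : MemVk k u) : MemVk k (F u) := by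
  obtain ⟨w, hw, hFw⟩ := hF u hu
  exact hFw ▸ hw.2.1 τ

lemma IsDGOp.eq_rescale (hpt : IsMesh pt) {β lam : ℝ}
    {L L' : (Fin N → Polynomial ℝ) → (Fin N → Polynomial ℝ)}
    (hL : IsDGOp k pt β L) (hL' : IsDGOp k pt (lam * β) L')
    {w : Fin N → Polynomial ℝ} (hw : MemVk k w) (j : Fin N) : L' w j = C lam * L w j := by
  refine hpt.eq_of_forall_cip_eq (j := j) ((hL' w hw).1 j)
    ((natDegree_C_mul_le _ _).trans ((hL w hw).1 j)) fun v hv => ?_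
  rw [cip_C_mul_left, (hL w hw).2 j v hv, (hL' w hw).2 j v hv]
  simp only [dgRHS]
  ring

variable {β lam τ : ℝ} {c d : ℕ → ℕ → ℝ} {ℓ : ℕ}
  {L L' : (Fin N → Polynomial ℝ) → (Fin N → Polynomial ℝ)}
  {v v' : ℕ → Fin N → Polynomial ℝ}

lemma IsDGOp.memVk_rkStage (hL : IsDGOp k pt β L) (hv : ∀ m ≤ ℓ, MemVk k (v m)) :
    MemVk k (rkStage c d τ L v ℓ) := fun j => by
  refine natDegree_sum_le_of_forall_le _ _ fun m hm => ?_
  have hm' := hv m (Nat.lt_succ_iff.1 (Finset.mem_range.1 hm))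
  exact natDegree_add_le_of_degree_le ((natDegree_C_mul_le _ _).trans (hm' j))
    ((natDegree_C_mul_le _ _).trans ((hL _ hm').1 j))

lemma IsDGOp.rkStage_rescale (hpt : IsMesh pt) (hlam : lam ≠ 0) (hL : IsDGOp k pt β L)
    (hL' : IsDGOp k pt (lam * β) L') (hv : ∀ m ≤ ℓ, MemVk k (v m))
    (hvv' : ∀ m ≤ ℓ, v' m = v m) :
    rkStage c d (τ / lam) L' v' ℓ = rkStage c d τ L v ℓ := by
  funext j
  refine Finset.sum_congr rfl fun m hm => ?_
  have hm' := Nat.lt_succ_iff.1 (Finset.mem_range.1 hm)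
  rw [hvv' m hm', hL.eq_rescale hpt hL' (hv m hm'), ← mul_assoc, ← C_mul]
  rw [show τ / lam * d ℓ m * lam = τ * d ℓ m by field_simp]

end Auxiliary

/-- Theorem 2.3: evolution invariance.  For `λ > 0`, let the scaled
scheme solve `u_t + λβ u_x = 0` on the same mesh with the same Runge–Kutta method,
time step `τ_λ = τ/λ`, the upwind DG operator `L'` for wave speed `λβ` (i.e. `λL`) and
OE wave speeds `β_j = λβ`; let the unscaled scheme solve `u_t + β u_x = 0` with time
step `τ`.  Starting from the same data, `E_n^λ = E_n` for all `n ≥ 0`. -/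
theorem oedg_evolution_invariant
    {N : ℕ} [NeZero N] (k s : ℕ) (hs : 1 ≤ s) (pt : Fin (N+1) → ℝ) (hpt : IsMesh pt)
    (β : ℝ) (hβ : 0 < β) (lam : ℝ) (hlam : 0 < lam)
    (c d : ℕ → ℕ → ℝ) (hc : ∀ ℓ < s, ∑ m ∈ Finset.range (ℓ+1), c ℓ m = 1)
    (τ : ℝ) (hτ : 0 < τ)
    (Pc : Fin N → ℕ → Polynomial ℝ → Polynomial ℝ) (hPc : IsCellProj pt Pc)
    (L Fτ L' Fτ' : (Fin N → Polynomial ℝ) → (Fin N → Polynomial ℝ))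
    (hL : IsDGOp k pt β L) (hFτ : IsOEOp k pt (fun _ => β) Pc τ Fτ)
    (hL' : IsDGOp k pt (lam * β) L')
    (hFτ' : IsOEOp k pt (fun _ => lam * β) Pc (τ / lam) Fτ')
    (u0 : Fin N → Polynomial ℝ) (hu0 : MemVk k u0)
    (uh uσ uh' uσ' : ℕ → ℕ → Fin N → Polynomial ℝ)
    (hev : IsOEDGEvol s c d τ L Fτ u0 uh uσ)
    (hev' : IsOEDGEvol s c d (τ / lam) L' Fτ' u0 uh' uσ') :
    ∀ n : ℕ, uσ' n 0 = uσ n 0 := by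
  have hlam' := hlam.ne'
  have stages (n : ℕ) (hmem : MemVk k (uσ n 0)) (heq : uσ' n 0 = uσ n 0) :
      ∀ ℓ ≤ s, MemVk k (uσ n ℓ) ∧ uσ' n ℓ = uσ n ℓ := by
    intro ℓ
    induction ℓ using Nat.strong_induction_on with
    | _ ℓ ih =>
      intro hℓ
      rcases ℓ with _ | ℓ
      · exact ⟨hmem, heq⟩
      have hprev (m : ℕ) (hm : m ≤ ℓ) := ih m (by omega) (by omega)
      obtain ⟨hh, hσ⟩ := (hev.2 n).2 ℓ (by omega)
      obtain ⟨hh', hσ'⟩ := (hev'.2 n).2 ℓ (by omega)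
      have huh : MemVk k (uh n (ℓ+1)) :=
        hh ▸ hL.memVk_rkStage fun m hm => (hprev m hm).1
      have huh' : uh' n (ℓ+1) = uh n (ℓ+1) := by
        rw [hh, hh', hL.rkStage_rescale hpt hlam' hL' (fun m hm => (hprev m hm).1)
          fun m hm => (hprev m hm).2]
      exact ⟨hσ ▸ hFτ.memVk huh, by rw [hσ, hσ', huh', hFτ.eq_rescale hpt hPc hlam' hFτ' huh]⟩
  suffices H : ∀ n, MemVk k (uσ n 0) ∧ uσ' n 0 = uσ n 0 from fun n => (H n).2
  intro n
  induction n with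
  | zero => exact ⟨hev.1 ▸ hu0, hev'.1.trans hev.1.symm⟩
  | succ n ih =>
    rw [(hev.2 n).1, (hev'.2 n).1]
    exact stages n ih.1 ih.2 s le_rfl
end OEDG
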